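/- Let n ∈ {2,3}, s ∈ ((n−1)/4, 1), r = (n−1)/4 + s, and λ₁ > 0. There exists a constant C > 0 (depending only on n, s, λ₁) such that for every k ∈ (0,1] and every λ ≥ λ₁, with 𝙽 = ⌈2π²/((s − (n−1)/4)k²)⌉ and 𝙼 = ⌈π²/((1 − s)k²)⌉, one has | ∫_{-∞}^{∞} e^{(1−s)y}/(e^y + λ) dy − k ∑_{l=−𝙼}^{𝙽} e^{(1−s)kl}/(e^{kl} + λ) | ≤ C e^{−π²/k} λ^{−r/2}. -/

import Mathlib

open MeasureTheory Real

lemma sq_integral (a : ℂ) (h0 : 0 < a.re) (h1 : a.re < 1) :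
    ∫ y : ℝ, Complex.exp (a * y) / ((Real.exp y : ℂ) + 1) = π / Complex.sin (π * a) := by
  have hG := Complex.Gamma_mul_Gamma_eq_betaIntegral (s := a) (t := 1 - a) h0 (by simpa using h1)
  rw [Complex.Gamma_mul_Gamma_one_sub] at hG
  rw [hG, Complex.betaIntegral, intervalIntegral.integral_of_le zero_le_one,
    integral_Ioc_eq_integral_Ioo, ← range_sigmoid, ← Set.image_univ,
    integral_image_eq_integral_abs_deriv_smul MeasurableSet.univ
      (fun x _ => (hasDerivAt_sigmoid x).hasDerivWithinAt) (sigmoid_injective.injOn)]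
  simp only [setIntegral_univ, add_sub_cancel, Complex.Gamma_one, one_mul]
  congr 1
  ext y
  have hp := sigmoid_pos y
  have hq := sigmoid_pos (-y)
  rw [abs_of_pos (by rw [← sigmoid_neg]; positivity), ← sigmoid_neg]
  have e1 : (1 : ℂ) - (sigmoid y : ℂ) = (sigmoid (-y) : ℝ) := by
    rw [sigmoid_neg]; push_cast; ring
  rw [e1]
  have hx : ∀ x : ℝ, (sigmoid x : ℝ) = Real.exp (- Real.log (1 + Real.exp (-x))) := by
    intro x
    rw [Real.exp_neg, Real.exp_log (by positivity), sigmoid_def]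
  have hl : Real.log (1 + Real.exp (-y)) = Real.log (1 + Real.exp y) - y := by
    rw [eq_sub_iff_add_eq]
    nth_rewrite 2 [← Real.log_exp y]
    rw [← Real.log_mul (by positivity) (by positivity)]
    congr 1
    rw [add_mul, ← Real.exp_add]; simp [add_comm]
  have hc : ∀ (x : ℝ) (b : ℂ), ((sigmoid x : ℝ) : ℂ) ^ b =
      Complex.exp (- Real.log (1 + Real.exp (-x)) * b) := by
    intro x b
    rw [Complex.cpow_def_of_ne_zero (by exact_mod_cast (sigmoid_pos x).ne'), ← Complex.ofReal_log (sigmoid_pos x).le, hx,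
      Real.log_exp]
    push_cast; rfl
  rw [hc, hc, Complex.real_smul]
  push_cast
  rw [hx, hx]
  rw [hl, neg_neg]
  have e2 : ((Real.exp y : ℂ) + 1) = Complex.exp (Real.log (1 + Real.exp y)) := by
    rw [← Complex.ofReal_exp, Real.exp_log (by positivity)]; push_cast; ring
  rw [← Complex.ofReal_exp, e2, ← Complex.exp_sub]
  push_cast
  simp only [← Complex.exp_add]
  congr 1
  ring

lemma sin_lower (x y : ℝ) (hx : 0 < Real.sin x) :
    Real.sin x * Real.exp |y| / 2 ≤ ‖Complex.sin (x + y * Complex.I)‖ := by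
  refine le_trans ?_ (Complex.re_le_norm _)
  have : (Complex.sin (x + y * Complex.I)).re = Real.sin x * Real.cosh y := by
    rw [Complex.sin_add_mul_I]
    rw [← Complex.ofReal_sin, ← Complex.ofReal_cosh, ← Complex.ofReal_cos, ← Complex.ofReal_sinh]
    simp [-Complex.ofReal_sin, -Complex.ofReal_cosh, -Complex.ofReal_cos, -Complex.ofReal_sinh]
  rw [this, ← Real.cosh_abs, Real.cosh_eq, mul_div_assoc]
  have := Real.exp_pos (-|y|)
  gcongr
  linarith

lemma fourier_bound (s : ℝ) (h0 : 0 < s) (h1 : s < 1) (k lam : ℝ) (hk : 0 < k) (hl : 0 < lam)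
    (m : ℝ) :
    k * ‖∫ t : ℝ, Complex.exp (((-2 * π * t * m : ℝ) : ℂ) * Complex.I) *
      ((Real.exp ((1 - s) * (k * t)) / (Real.exp (k * t) + lam) : ℝ) : ℂ)‖ ≤
      2 * π / Real.sin (π * (1 - s)) * Real.exp (-(2 * π ^ 2 * |m| / k)) * lam ^ (-s) := by
  set a : ℂ := ((1 - s : ℝ) : ℂ) + ((-2 * π * m / k : ℝ) : ℂ) * Complex.I with ha
  have hre : a.re = 1 - s := by
    rw [ha, Complex.add_re, Complex.re_ofReal_mul, Complex.ofReal_re]; simp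
  have key : ∀ t : ℝ, Complex.exp (((-2 * π * t * m : ℝ) : ℂ) * Complex.I) *
      ((Real.exp ((1 - s) * (k * t)) / (Real.exp (k * t) + lam) : ℝ) : ℂ) =
      (Complex.exp (a * (Real.log lam : ℝ)) / lam) *
        (fun y : ℝ => (fun y : ℝ => Complex.exp (a * y) / ((Real.exp y : ℂ) + 1))
          (y - Real.log lam)) (k * t) := by
    intro t
    have hlc : (lam : ℂ) ≠ 0 := by exact_mod_cast hl.ne'
    have hd : ((Real.exp (k * t) + lam : ℝ) : ℂ) ≠ 0 := by
      exact_mod_cast (by positivity : Real.exp (k * t) + lam ≠ 0)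
    have e1 : ((Real.exp (k * t - Real.log lam) : ℝ) : ℂ) + 1
        = ((Real.exp (k * t) + lam : ℝ) : ℂ) / lam := by
      rw [Real.exp_sub, Real.exp_log hl]; push_cast; field_simp
    simp only []
    rw [e1, Complex.ofReal_div]
    field_simp
    rw [Complex.ofReal_exp, ← Complex.exp_add, ← Complex.exp_add]
    congr 1
    have : (k : ℂ) ≠ 0 := by exact_mod_cast hk.ne'
    have hak : a * k = (1 - s) * k - 2 * π * m * Complex.I := by
      rw [ha]; push_cast; field_simp; ring
    have : a * ((t * k - Real.log lam : ℝ) : ℂ) = (a * k) * t - a * (Real.log lam : ℝ) := by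
      push_cast; ring
    rw [this, hak]
    push_cast
    ring_nf
  simp_rw [key]
  rw [integral_const_mul, Measure.integral_comp_mul_left
    (fun y : ℝ => (fun y : ℝ => Complex.exp (a * y) / ((Real.exp y : ℂ) + 1))
          (y - Real.log lam)), integral_sub_right_eq_self
    (fun y : ℝ => Complex.exp (a * y) / ((Real.exp y : ℂ) + 1)), sq_integral a (by linarith) (by linarith)]
  have hs : 0 < Real.sin (π * (1 - s)) :=
    Real.sin_pos_of_pos_of_lt_pi (by have := Real.pi_pos; nlinarith) (by have := Real.pi_pos; nlinarith)
  have hlow := sin_lower (π * (1 - s)) (π * (-2 * π * m / k)) hs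
  have e3 : (((π * (1 - s) : ℝ) : ℂ) + ((π * (-2 * π * m / k) : ℝ) : ℂ) * Complex.I) = π * a := by
    rw [ha]; push_cast; ring
  rw [e3] at hlow
  have e4 : |π * (-2 * π * m / k)| = 2 * π ^ 2 * |m| / k := by
    rw [abs_mul, abs_div, abs_mul, abs_mul, abs_of_pos hk, abs_of_pos Real.pi_pos]; norm_num; ring
  rw [e4] at hlow
  have e5 : ‖Complex.exp (a * (Real.log lam : ℝ)) / lam‖ = lam ^ (-s) := by
    rw [norm_div, Complex.norm_exp, mul_comm a, Complex.re_ofReal_mul, hre, Complex.norm_real,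
      Real.norm_of_nonneg hl.le, ← Real.rpow_def_of_pos hl, ← Real.rpow_sub_one hl.ne']
    congr 1; ring
  rw [norm_mul, e5, norm_smul, norm_div, Complex.norm_real, Real.norm_of_nonneg Real.pi_pos.le,
    Real.norm_of_nonneg (by positivity), abs_of_pos (by positivity)]
  have : π / ‖Complex.sin (π * a)‖ ≤ 2 * π / Real.sin (π * (1 - s)) * Real.exp (-(2 * π ^ 2 * |m| / k)) := by
    rw [Real.exp_neg]
    calc _ ≤ π / (Real.sin (π * (1 - s)) * Real.exp (2 * π ^ 2 * |m| / k) / 2) := by gcongr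
      _ = _ := by field_simp
  calc _ = (π / ‖Complex.sin (π * a)‖) * lam ^ (-s) := by field_simp
    _ ≤ _ := by gcongr

lemma tail_bound (a k A : ℝ) (ha : 0 < a) (hk : 0 < k) (hA : 0 ≤ A) (u : ℕ → ℝ)
    (hu : ∀ n, 0 ≤ u n) (hu' : ∀ n : ℕ, u n ≤ A * Real.exp (-(a * k * (n + 1)))) :
    Summable u ∧ 0 ≤ k * ∑' n, u n ∧ k * ∑' n, u n ≤ A / a := by
  set q := Real.exp (-(a * k)) with hq
  have hq1 : q < 1 := by rw [hq, Real.exp_lt_one_iff]; have := mul_pos ha hk; linarith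
  have hq0 : 0 < q := Real.exp_pos _
  have e : ∀ n : ℕ, A * Real.exp (-(a * k * (n + 1))) = A * q * q ^ n := by
    intro n
    rw [hq, mul_assoc A, ← Real.exp_nat_mul, ← Real.exp_add]; congr 2; ring
  have hg := (hasSum_geometric_of_lt_one hq0.le hq1).mul_left (A * q)
  have hsum : Summable u := Summable.of_nonneg_of_le hu (fun n => (hu' n).trans (e n).le) hg.summable
  refine ⟨hsum, mul_nonneg hk.le (tsum_nonneg hu), ?_⟩
  have h1 : ∑' n, u n ≤ A * q * (1 - q)⁻¹ := by
    rw [← hg.tsum_eq]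
    exact hsum.tsum_le_tsum (fun n => (hu' n).trans (e n).le) hg.summable
  have h2 : a * k * q ≤ 1 - q := by
    have := Real.add_one_le_exp (a * k)
    have h3 : q * Real.exp (a * k) = 1 := by rw [hq, ← Real.exp_add]; simp
    nlinarith
  calc _ ≤ k * (A * q * (1 - q)⁻¹) := by gcongr
    _ = A / a * ((a * k * q) / (1 - q)) := by field_simp
    _ ≤ A / a * 1 := by
      gcongr
      rw [div_le_one (by linarith)]; exact h2
    _ = _ := mul_one _

lemma F_le_right (s k lam t : ℝ) (hl : 0 < lam) :
    Real.exp ((1 - s) * (k * t)) / (Real.exp (k * t) + lam) ≤ Real.exp (-(s * k * t)) := by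
  rw [div_le_iff₀ (by positivity)]
  have e : Real.exp ((1 - s) * (k * t)) = Real.exp (-(s * k * t)) * Real.exp (k * t) := by
    rw [← Real.exp_add]; congr 1; ring
  rw [e]
  gcongr; linarith

lemma F_le_left (s k lam t : ℝ) (hl : 0 < lam) :
    Real.exp ((1 - s) * (k * t)) / (Real.exp (k * t) + lam) ≤
      lam⁻¹ * Real.exp ((1 - s) * (k * t)) := by
  rw [inv_mul_eq_div]
  gcongr
  have := Real.exp_pos (k * t)
  linarith

lemma F_decay (s : ℝ) (h0 : 0 < s) (h1 : s < 1) (k lam : ℝ) (hk : 0 < k) (hl : 0 < lam) (t : ℝ) :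
    Real.exp ((1 - s) * (k * t)) / (Real.exp (k * t) + lam) ≤
      (1 + lam⁻¹) * Real.exp (-(k * min s (1 - s) * |t|)) := by
  have hli : 0 < lam⁻¹ := by positivity
  rcases le_total 0 t with ht | ht
  · refine (F_le_right s k lam t hl).trans ?_
    rw [abs_of_nonneg ht]
    have : Real.exp (-(s * k * t)) ≤ Real.exp (-(k * min s (1 - s) * t)) := by
      apply Real.exp_le_exp.mpr
      have : k * min s (1 - s) * t ≤ k * s * t := by gcongr; exact min_le_left _ _
      linarith
    have := Real.exp_pos (-(k * min s (1 - s) * t))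
    nlinarith
  · refine (F_le_left s k lam t hl).trans ?_
    rw [abs_of_nonpos ht]
    have : Real.exp ((1 - s) * (k * t)) ≤ Real.exp (-(k * min s (1 - s) * (-t))) := by
      apply Real.exp_le_exp.mpr
      have h : 0 ≤ -t := by linarith
      have : k * min s (1 - s) * (-t) ≤ k * (1 - s) * (-t) := by gcongr; exact min_le_right _ _
      linarith
    gcongr
    linarith

lemma summable_expabs : Summable (fun m : ℤ => Real.exp (-|(m : ℝ)|)) := by
  rw [summable_int_iff_summable_nat_and_neg]
  constructor
  · simpa using Real.summable_exp_neg_nat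
  · simpa using Real.summable_exp_neg_nat

open FourierTransform in
lemma poisson_err (s : ℝ) (h0 : 0 < s) (h1 : s < 1) : ∃ B : ℝ, 0 < B ∧
    ∀ k ∈ Set.Ioc (0 : ℝ) 1, ∀ lam : ℝ, 0 < lam →
      |(∫ y : ℝ, Real.exp ((1 - s) * y) / (Real.exp y + lam)) -
        k * ∑' l : ℤ, Real.exp ((1 - s) * (k * (l : ℝ))) / (Real.exp (k * (l : ℝ)) + lam)| ≤
      B * Real.exp (-π ^ 2 / k) * lam ^ (-s) := by
  have hs : 0 < Real.sin (π * (1 - s)) :=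
    Real.sin_pos_of_pos_of_lt_pi (by have := Real.pi_pos; nlinarith) (by have := Real.pi_pos; nlinarith)
  refine ⟨2 * π / Real.sin (π * (1 - s)) * ∑' m : ℤ, Real.exp (-|(m : ℝ)|), ?_, ?_⟩
  · have : 0 < ∑' m : ℤ, Real.exp (-|(m : ℝ)|) :=
      summable_expabs.tsum_pos (fun _ => (Real.exp_pos _).le) 0 (Real.exp_pos _)
    positivity
  rintro k ⟨hk, hk1⟩ lam hl
  set f : ℝ → ℝ := fun t => Real.exp ((1 - s) * (k * t)) / (Real.exp (k * t) + lam) with hf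
  set F : ℝ → ℂ := fun t => ((f t : ℝ) : ℂ) with hF
  have hcont : Continuous F := by
    apply Complex.continuous_ofReal.comp
    apply Continuous.div (by fun_prop) (by fun_prop)
    intro t; positivity
  have hdec : F =O[Filter.cocompact ℝ] fun x : ℝ => |x| ^ (-(2:ℝ)) := by
    have hc : 0 < k * min s (1 - s) := mul_pos hk (lt_min h0 (by linarith))
    set c := k * min s (1 - s) with hcd
    apply Asymptotics.IsBigO.of_bound ((1 + lam⁻¹) * (2 / c ^ 2))
    filter_upwards [(isCompact_singleton (x := (0 : ℝ))).compl_mem_cocompact] with t ht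
    have ht' : 0 < |t| := abs_pos.mpr (by simpa using ht)
    have hfn : 0 ≤ f t := by simp only [hf]; positivity
    rw [hF]
    simp only [Complex.norm_real, Real.norm_of_nonneg hfn]
    refine (F_decay s h0 h1 k lam hk hl t).trans ?_
    rw [Real.norm_of_nonneg (by positivity), mul_assoc (1 + lam⁻¹)]
    gcongr
    rw [Real.exp_neg, Real.rpow_neg (abs_nonneg _), Real.rpow_two]
    have := Real.quadratic_le_exp_of_nonneg (x := c * |t|) (by positivity)
    calc (Real.exp (c * |t|))⁻¹ ≤ ((c * |t|) ^ 2 / 2)⁻¹ := by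
          apply inv_anti₀ (by positivity)
          have : 0 < c * |t| := by positivity
          linarith
      _ = _ := by field_simp
  have hFour : ∀ m : ℝ, 𝓕 F m = ∫ t : ℝ, Complex.exp (((-2 * π * t * m : ℝ) : ℂ) * Complex.I) *
      ((Real.exp ((1 - s) * (k * t)) / (Real.exp (k * t) + lam) : ℝ) : ℂ) := by
    intro m
    rw [Real.fourier_real_eq_integral_exp_smul]
    rfl
  set A := 2 * π / Real.sin (π * (1 - s)) with hA
  have hA0 : 0 < A := by positivity
  have hbd : ∀ m : ℝ, ‖𝓕 F m‖ ≤ k⁻¹ * (A * Real.exp (-(2 * π ^ 2 * |m| / k)) * lam ^ (-s)) := by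
    intro m
    rw [hFour, le_inv_mul_iff₀ hk]
    exact fourier_bound s h0 h1 k lam hk hl m
  have hbd2 : ∀ m : ℤ, m ≠ 0 → ‖𝓕 F m‖ ≤
      k⁻¹ * (A * Real.exp (-π ^ 2 / k) * lam ^ (-s)) * Real.exp (-|(m : ℝ)|) := by
    intro m hm
    refine (hbd m).trans ?_
    have : Real.exp (-(2 * π ^ 2 * |(m : ℝ)| / k)) ≤ Real.exp (-π ^ 2 / k) * Real.exp (-|(m : ℝ)|) := by
      rw [← Real.exp_add]
      apply Real.exp_le_exp.mpr
      have hm1 : 1 ≤ |(m : ℝ)| := by exact_mod_cast Int.one_le_abs hm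
      have hpi : 1 ≤ π ^ 2 := by have := Real.pi_gt_three; nlinarith
      have hpk : π ^ 2 ≤ π ^ 2 / k := by rw [le_div_iff₀ hk]; nlinarith
      have e : 2 * π ^ 2 * |(m : ℝ)| / k = 2 * (π ^ 2 / k) * |(m : ℝ)| := by ring
      have e' : -π ^ 2 / k = - (π ^ 2 / k) := by ring
      rw [e, e']
      nlinarith
    calc _ ≤ k⁻¹ * (A * (Real.exp (-π ^ 2 / k) * Real.exp (-|(m : ℝ)|)) * lam ^ (-s)) := by gcongr
      _ = _ := by ring
  have hsum : Summable fun m : ℤ => 𝓕 F m := by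
    apply Summable.of_norm_bounded_eventually
      (summable_expabs.mul_left (k⁻¹ * (A * Real.exp (-π ^ 2 / k) * lam ^ (-s))))
    filter_upwards [(Set.finite_singleton (0 : ℤ)).compl_mem_cofinite] with m hm
    exact hbd2 m (by simpa using hm)
  have hP := Real.tsum_eq_tsum_fourier_of_rpow_decay_of_summable hcont one_lt_two hdec hsum 0
  simp only [zero_add, AddCircle.coe_zero, fourier_eval_zero, mul_one] at hP
  rw [hsum.tsum_eq_add_tsum_ite 0] at hP
  have hz : 𝓕 F ((0 : ℤ) : ℝ) = ((k⁻¹ * ∫ y : ℝ, Real.exp ((1 - s) * y) / (Real.exp y + lam) : ℝ) : ℂ) := by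
    rw [hFour]
    simp only [Int.cast_zero, mul_zero, Complex.ofReal_zero, zero_mul, Complex.exp_zero, one_mul]
    rw [integral_complex_ofReal]
    congr 1
    rw [Measure.integral_comp_mul_left (fun y => Real.exp ((1 - s) * y) / (Real.exp y + lam)),
      abs_of_pos (by positivity), smul_eq_mul]
  have hE : ‖∑' m : ℤ, ite (m = 0) 0 (𝓕 F m)‖ ≤
      k⁻¹ * (A * Real.exp (-π ^ 2 / k) * lam ^ (-s)) * ∑' m : ℤ, Real.exp (-|(m : ℝ)|) := by
    refine tsum_of_norm_bounded (summable_expabs.hasSum.mul_left _) ?_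
    intro m
    split_ifs with h
    · rw [norm_zero]; positivity
    · exact hbd2 m h
  have hP2 : ∑' m : ℤ, ite (m = 0) 0 (𝓕 F m) = ((∑' l : ℤ, f l -
      k⁻¹ * ∫ y : ℝ, Real.exp ((1 - s) * y) / (Real.exp y + lam) : ℝ) : ℂ) := by
    rw [hz] at hP
    rw [Complex.ofReal_sub, Complex.ofReal_tsum, hP]
    ring
  rw [hP2, Complex.norm_real, Real.norm_eq_abs] at hE
  have e : (∫ y : ℝ, Real.exp ((1 - s) * y) / (Real.exp y + lam)) - k * ∑' l : ℤ, f l =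
    - (k * (∑' l : ℤ, f l - k⁻¹ * ∫ y : ℝ, Real.exp ((1 - s) * y) / (Real.exp y + lam))) := by
    field_simp; ring
  change |(∫ y : ℝ, Real.exp ((1 - s) * y) / (Real.exp y + lam)) - k * ∑' l : ℤ, f l| ≤ _
  rw [e, abs_neg, abs_mul, abs_of_pos hk]
  refine (mul_le_mul_of_nonneg_left hE hk.le).trans (le_of_eq ?_)
  field_simp

lemma sum_Icc_split (f : ℤ → ℝ) (M N : ℕ) :
    ∑ l ∈ Finset.Icc (-(M : ℤ)) (N : ℤ), f l =
      ∑ i ∈ Finset.range (N + 1), f (i : ℤ) + ∑ i ∈ Finset.range M, f (-((i : ℤ) + 1)) := by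
  induction M with
  | zero =>
    induction N with
    | zero => simp
    | succ N ih =>
      rw [Finset.sum_range_succ, add_right_comm, ← ih]
      have : Finset.Icc (-((0 : ℕ) : ℤ)) ((N + 1 : ℕ) : ℤ) =
          insert ((N + 1 : ℕ) : ℤ) (Finset.Icc (-((0 : ℕ) : ℤ)) (N : ℤ)) := by
        ext x; simp only [Finset.mem_Icc, Finset.mem_insert]; omega
      rw [this, Finset.sum_insert (by simp), add_comm]
  | succ M ih =>
    rw [Finset.sum_range_succ _ M, ← add_assoc, ← ih]
    have : Finset.Icc (-((M + 1 : ℕ) : ℤ)) (N : ℤ) =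
        insert (-((M : ℤ) + 1)) (Finset.Icc (-(M : ℤ)) (N : ℤ)) := by
      ext x; simp only [Finset.mem_Icc, Finset.mem_insert]; omega
    rw [this, Finset.sum_insert (by simp), add_comm]

/-- Weighted AM-GM style lower bound. -/
lemma F_le_mid (s k lam t q : ℝ) (hl : 0 < lam) (hq0 : 0 ≤ q) (hq1 : q ≤ 1) :
    Real.exp ((1 - s) * (k * t)) / (Real.exp (k * t) + lam) ≤
      lam ^ (-q) * Real.exp (-((s - q) * k * t)) := by
  rw [div_le_iff₀ (by positivity)]
  have hE := Real.exp_pos (k * t)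
  have h : Real.exp (k * t) ^ (1 - q) * lam ^ q ≤ Real.exp (k * t) + lam := by
    calc _ ≤ (Real.exp (k * t) + lam) ^ (1 - q) * (Real.exp (k * t) + lam) ^ q := by
          gcongr <;> linarith
      _ = _ := by rw [← Real.rpow_add (by positivity)]; simp
  have e : Real.exp ((1 - s) * (k * t)) = lam ^ (-q) * Real.exp (-((s - q) * k * t)) *
      (Real.exp (k * t) ^ (1 - q) * lam ^ q) := by
    rw [Real.rpow_neg hl.le, ← Real.exp_mul]
    have : 0 < lam ^ q := by positivity
    field_simp
    rw [← Real.exp_add]; congr 1; ring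
  rw [e]
  gcongr

lemma rpow_compare (lam1 lam p q : ℝ) (h1 : 0 < lam1) (h : lam1 ≤ lam) (hpq : q ≤ p) :
    lam ^ (-p) ≤ lam1 ^ (q - p) * lam ^ (-q) := by
  have hl : 0 < lam := by linarith
  have e : lam ^ (-p) = lam ^ (q - p) * lam ^ (-q) := by
    rw [← Real.rpow_add hl]; congr 1; ring
  rw [e]
  exact mul_le_mul_of_nonneg_right (Real.rpow_le_rpow_of_nonpos h1 h (by linarith))
    (by positivity)

theorem sinc_quadrature_scalar_error (n : ℕ) (hn : n = 2 ∨ n = 3)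
    (s : ℝ) (hs : s ∈ Set.Ioo (((n : ℝ) - 1) / 4) 1)
    (r : ℝ) (hr : r = ((n : ℝ) - 1) / 4 + s)
    (lam1 : ℝ) (hlam1 : 0 < lam1) :
    ∃ C : ℝ, 0 < C ∧ ∀ k ∈ Set.Ioc (0 : ℝ) 1, ∀ lam : ℝ, lam1 ≤ lam →
      |(∫ y : ℝ, Real.exp ((1 - s) * y) / (Real.exp y + lam)) -
          k * ∑ l ∈ Finset.Icc
              (-(⌈Real.pi ^ 2 / ((1 - s) * k ^ 2)⌉₊ : ℤ))
              ((⌈2 * Real.pi ^ 2 / ((s - ((n : ℝ) - 1) / 4) * k ^ 2)⌉₊ : ℤ)),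
            Real.exp ((1 - s) * (k * (l : ℝ))) / (Real.exp (k * (l : ℝ)) + lam)|
        ≤ C * Real.exp (-Real.pi ^ 2 / k) * lam ^ (-(r / 2)) := by
  obtain ⟨hs0, hs1⟩ := hs
  have hd : 0 < ((n : ℝ) - 1) / 4 := by
    rcases hn with rfl | rfl <;> norm_num
  set d := ((n : ℝ) - 1) / 4 with hdd
  have h0 : 0 < s := by linarith
  obtain ⟨B, hB, hBb⟩ := poisson_err s h0 hs1
  set a := (s - d) / 2 with ha
  have ha0 : 0 < a := by rw [ha]; linarith
  have hsr : s - r / 2 = a := by rw [ha, hr]; ring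
  have h1s : 0 < 1 - s := by linarith
  refine ⟨B * lam1 ^ (r / 2 - s) + 1 / a + lam1 ^ (r / 2 - 1) / (1 - s), by positivity, ?_⟩
  rintro k ⟨hk, hk1⟩ lam hlam
  have hl : 0 < lam := by linarith
  set N := ⌈2 * Real.pi ^ 2 / ((s - d) * k ^ 2)⌉₊ with hN
  set M := ⌈Real.pi ^ 2 / ((1 - s) * k ^ 2)⌉₊ with hM
  have hN1 : π ^ 2 / k ≤ a * k * N := by
    have := Nat.le_ceil (2 * Real.pi ^ 2 / ((s - d) * k ^ 2))
    rw [← hN] at this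
    calc π ^ 2 / k = a * k * (2 * Real.pi ^ 2 / ((s - d) * k ^ 2)) := by
          have : s - d ≠ 0 := by linarith
          rw [ha]; field_simp
      _ ≤ _ := by gcongr
  have hM1 : π ^ 2 / k ≤ (1 - s) * k * M := by
    have := Nat.le_ceil (Real.pi ^ 2 / ((1 - s) * k ^ 2))
    rw [← hM] at this
    calc π ^ 2 / k = (1 - s) * k * (Real.pi ^ 2 / ((1 - s) * k ^ 2)) := by
          field_simp
      _ ≤ _ := by gcongr
  set E := Real.exp (-Real.pi ^ 2 / k) with hE
  have hE0 : 0 < E := Real.exp_pos _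
  set f : ℤ → ℝ := fun l => Real.exp ((1 - s) * (k * (l : ℝ))) / (Real.exp (k * (l : ℝ)) + lam)
    with hf
  have hfn : ∀ l, 0 ≤ f l := fun l => by simp only [hf]; positivity
  have hmain : |(∫ y : ℝ, Real.exp ((1 - s) * y) / (Real.exp y + lam)) - k * ∑' l : ℤ, f l| ≤
      B * E * lam ^ (-s) := hBb k ⟨hk, hk1⟩ lam hl
  obtain ⟨hS1, hp1, ht1⟩ := tail_bound a k (lam ^ (-(r / 2)) * E) ha0 hk (by positivity)
    (fun i : ℕ => f ((i + (N + 1) : ℕ) : ℤ)) (fun i => hfn _) (by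
      intro i
      refine (F_le_mid s k lam _ (r / 2) hl (by linarith) (by linarith)).trans ?_
      rw [mul_assoc (lam ^ (-(r / 2))), hsr]
      gcongr
      rw [hE, ← Real.exp_add]
      apply Real.exp_le_exp.mpr
      push_cast
      rw [neg_div]
      linarith)
  obtain ⟨hS2, hp2, ht2⟩ := tail_bound (1 - s) k (lam⁻¹ * E) h1s hk (by positivity)
    (fun i : ℕ => f (-(((i + M : ℕ) : ℤ) + 1))) (fun i => hfn _) (by
      intro i
      refine (F_le_left s k lam _ hl).trans ?_
      rw [mul_assoc lam⁻¹]
      gcongr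
      rw [hE, ← Real.exp_add]
      apply Real.exp_le_exp.mpr
      push_cast
      rw [neg_div]
      linarith)
  have hS1' : Summable (fun i : ℕ => f (i : ℤ)) := (summable_nat_add_iff (N + 1)).mp hS1
  have hS2' : Summable (fun i : ℕ => f (-((i : ℤ) + 1))) :=
    (summable_nat_add_iff (f := fun i : ℕ => f (-((i : ℤ) + 1))) M).mp hS2
  have hT := tsum_of_nat_of_neg_add_one hS1' hS2'
  rw [← hS1'.sum_add_tsum_nat_add (N + 1), ← hS2'.sum_add_tsum_nat_add M] at hT
  rw [sum_Icc_split f M N]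
  have hc1 := rpow_compare lam1 lam s (r / 2) hlam1 hlam (by linarith)
  have hc2 := rpow_compare lam1 lam 1 (r / 2) hlam1 hlam (by linarith)
  rw [Real.rpow_neg_one] at hc2
  set T1 := ∑' i : ℕ, f ((i + (N + 1) : ℕ) : ℤ)
  set T2 := ∑' i : ℕ, f (-(((i + M : ℕ) : ℤ) + 1))
  set I := ∫ y : ℝ, Real.exp ((1 - s) * y) / (Real.exp y + lam)
  set S1 := ∑ i ∈ Finset.range (N + 1), f (i : ℤ)
  set S2 := ∑ i ∈ Finset.range M, f (-((i : ℤ) + 1))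
  have e : I - k * (S1 + S2) = (I - k * ∑' l : ℤ, f l) + (k * T1 + k * T2) := by
    rw [hT]; ring
  rw [e]
  refine (abs_add_le _ _).trans ?_
  rw [abs_of_nonneg (add_nonneg hp1 hp2)]
  have b1 : B * E * lam ^ (-s) ≤ B * E * (lam1 ^ (r / 2 - s) * lam ^ (-(r / 2))) := by gcongr
  have b2 : lam⁻¹ * E / (1 - s) ≤ lam1 ^ (r / 2 - 1) * lam ^ (-(r / 2)) * E / (1 - s) := by gcongr
  calc _ ≤ B * E * (lam1 ^ (r / 2 - s) * lam ^ (-(r / 2))) + (lam ^ (-(r / 2)) * E / a +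
        lam1 ^ (r / 2 - 1) * lam ^ (-(r / 2)) * E / (1 - s)) := by linarith
    _ = _ := by ring
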